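/- arXiv:2411.02821 — 3 statements merged into one kernel-verified Lean document; each statement's English description precedes it below -/
import Mathlib

section
/- Let T be an M-consistent bipartite tournament for some M ⊆ V(T) and let (X_1, Y_1, X_2, Y_2, …) be the M-sequence of T. Then every feedback vertex set of T that is disjoint from M contains at least one endpoint of every long back edge, i.e., of every arc (u,v) with u in block i, v in block j and i − j ≥ 2. -/
open Set

variable {V : Type*}

/-- The arc relation `E` restricted to the vertex set `S` has no directed cycle. -/
def AcyclicOn (E : V → V → Prop) (S : Set V) : Prop :=
  ∀ v : V, ¬ Relation.TransGen (fun x y => x ∈ S ∧ y ∈ S ∧ E x y) v v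

/-- `E` is a bipartite tournament with partite sets `A` and `B`. -/
def IsBipartiteTournament (E : V → V → Prop) (A B : Set V) : Prop :=
  A ∪ B = Set.univ ∧ A ∩ B = ∅ ∧
  (∀ a ∈ A, ∀ b ∈ B, Xor' (E a b) (E b a)) ∧
  (∀ u ∈ A, ∀ v ∈ A, ¬ E u v) ∧
  (∀ u ∈ B, ∀ v ∈ B, ¬ E u v)

/-- `H` is a feedback vertex set: deleting `H` leaves an acyclic digraph. -/
def IsFVS (E : V → V → Prop) (H : Set V) : Prop := AcyclicOn E Hᶜ

/-- A directed cycle of length 4 (a square) on the distinct vertices `a b c d`. -/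
def IsDirSquare (E : V → V → Prop) (a b c d : V) : Prop :=
  a ≠ b ∧ a ≠ c ∧ a ≠ d ∧ b ≠ c ∧ b ≠ d ∧ c ≠ d ∧
  E a b ∧ E b c ∧ E c d ∧ E d a

/-- Out-neighborhood. -/
def OutN (E : V → V → Prop) (v : V) : Set V := {u | E v u}

/-- In-neighborhood. -/
def InN (E : V → V → Prop) (v : V) : Set V := {u | E u v}

/-- The union `X 1 ∪ ⋯ ∪ X (i-1)` of the sets preceding index `i` (1-based). -/
def SeqPrev (X : ℕ → Set V) (i : ℕ) : Set V := {v | ∃ j, 1 ≤ j ∧ j < i ∧ v ∈ X j}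

/-- `X 1, …, X l` is the canonical sequence of the digraph induced by `E` on `S`:
`X i` is the set of vertices with no incoming arc in the graph induced on
`S \ (X 1 ∪ ⋯ ∪ X (i-1))`, `l` is minimal with `X 1 ∪ ⋯ ∪ X l = S`, and
`X` is `∅` outside the indices `1, …, l`. -/
def IsCanonicalSeq (E : V → V → Prop) (S : Set V) (l : ℕ) (X : ℕ → Set V) : Prop :=
  (∀ i, 1 ≤ i → i ≤ l →
    X i = {v | v ∈ S ∧ v ∉ SeqPrev X i ∧ ∀ u ∈ S, u ∉ SeqPrev X i → ¬ E u v}) ∧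
  SeqPrev X (l + 1) = S ∧
  (∀ l', l' < l → SeqPrev X (l' + 1) ≠ S) ∧
  (∀ i, i = 0 ∨ l < i → X i = ∅)

/-- The digraph induced on `S` is `M`-consistent: for every `v ∈ S` the induced
subgraph on `M ∪ {v}` is acyclic. -/
def MConsistentOn (E : V → V → Prop) (S M : Set V) : Prop :=
  ∀ v ∈ S, AcyclicOn E (M ∪ {v})

/-- `u` and `v` are `M`-equivalent. -/
def MEquiv (E : V → V → Prop) (M : Set V) (u v : V) : Prop :=
  OutN E u ∩ M = OutN E v ∩ M ∧ InN E u ∩ M = InN E v ∩ M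

/-- `v` is `(M, X i)`-equivalent: `v` is `M`-equivalent to a vertex of `X i`. -/
def MXEquiv (E : V → V → Prop) (M : Set V) (X : ℕ → Set V) (i : ℕ) (v : V) : Prop :=
  ∃ u ∈ X i, MEquiv E M v u

/-- `v` is `(M, X i)`-conflicting. -/
def MXConflict (E : V → V → Prop) (X : ℕ → Set V) (i : ℕ) (v : V) : Prop :=
  (OutN E v ∩ X i).Nonempty ∧ (InN E v ∩ X i).Nonempty ∧
  (∀ j, j < i → OutN E v ∩ X j = ∅) ∧
  (∀ j, i < j → InN E v ∩ X j = ∅)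

/-- `π` is a topological sort of the digraph induced by `E` on `S`. -/
def IsTopSortOn (E : V → V → Prop) (S : Set V) (π : V → ℕ) : Prop :=
  Set.InjOn π S ∧ ∀ u ∈ S, ∀ w ∈ S, E u w → π u < π w

/-- `v` is `M⁻`-universal (w.r.t. the canonical sequence `X` of `T[M]`). -/
def MUnivMinus (E : V → V → Prop) (M : Set V) (X : ℕ → Set V) (v : V) : Prop :=
  (∀ i, ¬ MXEquiv E M X i v) ∧ AcyclicOn E (M ∪ {v}) ∧
  ∃ π : V → ℕ, IsTopSortOn E (M ∪ {v}) π ∧ ∀ u ∈ M ∪ {v}, u ≠ v → π v < π u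

/-- `v` is `M⁺`-universal (w.r.t. the canonical sequence `X` of `T[M]`). -/
def MUnivPlus (E : V → V → Prop) (M : Set V) (X : ℕ → Set V) (v : V) : Prop :=
  (∀ i, ¬ MXEquiv E M X i v) ∧ AcyclicOn E (M ∪ {v}) ∧
  ∃ π : V → ℕ, IsTopSortOn E (M ∪ {v}) π ∧ ∀ u ∈ M ∪ {v}, u ≠ v → π u < π v

/-- `v` is `M`-universal. -/
def MUniversal (E : V → V → Prop) (M : Set V) (X : ℕ → Set V) (v : V) : Prop :=
  MUnivMinus E M X v ∨ MUnivPlus E M X v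

/-- `(X 1, Y 1, …, X l, Y l)` is the `M`-sequence of the digraph induced by `E` on
the vertex set `S`, where `X'` is the canonical sequence of `T[M]`:  `X i` is the set
of all `(M, X' i)`-equivalent vertices of `S` and `Y i` the set of all
`(M, X' i)`-conflicting vertices of `S`, with `Y 1` additionally containing every
`M⁻`-universal vertex and `Y l` every `M⁺`-universal vertex of `S`. -/
def IsMSeqOn (E : V → V → Prop) (S M : Set V) (l : ℕ) (X' X Y : ℕ → Set V) : Prop :=
  IsCanonicalSeq E M l X' ∧
  (∀ i, 1 ≤ i → i ≤ l → X i = {w | w ∈ S ∧ MXEquiv E M X' i w}) ∧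
  (∀ i, 1 ≤ i → i ≤ l → Y i =
    {w | w ∈ S ∧ MXConflict E X' i w} ∪
    (if i = 1 then {w | w ∈ S ∧ MUnivMinus E M X' w} else ∅) ∪
    (if i = l then {w | w ∈ S ∧ MUnivPlus E M X' w} else ∅)) ∧
  (∀ i, i = 0 ∨ l < i → X i = ∅ ∧ Y i = ∅)

/-- Every collection of at least `t` consecutive vertices of `π` restricted to `S`
contains a vertex of `M`. -/
def ConsecHitsOn (π : V → ℕ) (S M : Set V) (t : ℝ) : Prop :=
  ∀ u ∈ S, ∀ w ∈ S, π u ≤ π w →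
    t ≤ ({x | x ∈ S ∧ π u ≤ π x ∧ π x ≤ π w}.ncard : ℝ) →
    ∃ m ∈ M ∩ S, π u ≤ π m ∧ π m ≤ π w

/-- A feedback vertex set `H` is `M`-homogeneous: some topological sort `π` of
`T − H` is such that every `10 (log₂ k)³` consecutive vertices of `π` restricted to
`A \ H`, respectively to `B \ H`, contain a vertex of `M`. -/
def MHomogeneous (E : V → V → Prop) (A B M H : Set V) (k : ℕ) : Prop :=
  ∃ π : V → ℕ, IsTopSortOn E Hᶜ π ∧
    ConsecHitsOn π (A \ H) M (10 * (Real.logb 2 k) ^ 3) ∧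
    ConsecHitsOn π (B \ H) M (10 * (Real.logb 2 k) ^ 3)

/-- The left boundary of block `i`: vertices of `X i` occurring before the first
`M`-vertex of `X i` in the topological sort `π`. -/
def LeftBd (π : V → ℕ) (X : ℕ → Set V) (M : Set V) (i : ℕ) : Set V :=
  {x | x ∈ X i ∧ ∀ m ∈ X i ∩ M, π x < π m}

/-- The right boundary of block `i`: vertices of `X i` occurring after the last
`M`-vertex of `X i` in the topological sort `π`. -/
def RightBd (π : V → ℕ) (X : ℕ → Set V) (M : Set V) (i : ℕ) : Set V :=
  {x | x ∈ X i ∧ ∀ m ∈ X i ∩ M, π m < π x}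

/-- The vicinity of block `i`. -/
def Vicinity (π : V → ℕ) (X Y : ℕ → Set V) (M : Set V) (i : ℕ) : Set V :=
  LeftBd π X M i ∪ RightBd π X M i ∪ Y i ∪ RightBd π X M (i - 1) ∪ LeftBd π X M (i + 1)

/-- `F` is a `t`-wise independent family of functions from `V` to `{1, …, q}`. -/
def TwiseIndep (F : Finset (V → ℕ)) (t q : ℕ) : Prop :=
  F.Nonempty ∧
  (∀ f ∈ F, ∀ v : V, f v ∈ Finset.Icc 1 q) ∧
  ∀ g : Fin t → V, Function.Injective g →
    ∀ α : Fin t → ℕ, (∀ i, α i ∈ Finset.Icc 1 q) →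
      (F.filter fun f => ∀ i, f (g i) = α i).card * q ^ t = F.card

/-- `u` and `v` are false twins. -/
def FalseTwins (E : V → V → Prop) (u v : V) : Prop :=
  ¬ E u v ∧ ¬ E v u ∧ OutN E u = OutN E v ∧ InN E u = InN E v

/-- The vertex set of a quadruple (used for vertex sets of squares). -/
def quadVerts (q : V × V × V × V) : Set V := {q.1, q.2.1, q.2.2.1, q.2.2.2}

namespace IsBipartiteTournament

variable {E : V → V → Prop} {A B : Set V}

theorem mem_left_or_right (hT : IsBipartiteTournament E A B) (x : V) : x ∈ A ∨ x ∈ B := by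
  have hx : x ∈ A ∪ B := hT.1 ▸ Set.mem_univ x
  exact hx

theorem adj_of_mem (hT : IsBipartiteTournament E A B) {a b : V} (ha : a ∈ A) (hb : b ∈ B) :
    E a b ∨ E b a :=
  (hT.2.2.1 a ha b hb).imp And.left And.left

/-- Every vertex is adjacent to one of the endpoints of any given arc. -/
theorem adj_left_or_adj_right (hT : IsBipartiteTournament E A B) {x y : V} (h : E x y) (z : V) :
    (E z x ∨ E x z) ∨ (E z y ∨ E y z) := by
  have := hT.mem_left_or_right
  have := hT.2.2.2
  have := @hT.adj_of_mem
  grind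

/-- The endpoints of a walk of length three are adjacent. -/
theorem adj_of_walk_three (hT : IsBipartiteTournament E A B) {a b c d : V}
    (hab : E a b) (hbc : E b c) (hcd : E c d) : E d a ∨ E a d := by
  have := hT.mem_left_or_right
  have := hT.2.2.2
  have := @hT.adj_of_mem
  grind

theorem irrefl (hT : IsBipartiteTournament E A B) (x : V) : ¬ E x x := by
  have := hT.mem_left_or_right
  have := hT.2.2.2
  grind

end IsBipartiteTournament

namespace IsCanonicalSeq

variable {E : V → V → Prop} {S : Set V} {l : ℕ} {X : ℕ → Set V}

theorem index_bounds (h : IsCanonicalSeq E S l X) {i : ℕ} {x : V} (hx : x ∈ X i) :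
    1 ≤ i ∧ i ≤ l := by
  by_contra hi
  have := h.2.2.2 i (by omega)
  simp_all

theorem mem_iff (h : IsCanonicalSeq E S l X) {i : ℕ} (hi : 1 ≤ i) (hil : i ≤ l) {x : V} :
    x ∈ X i ↔ x ∈ S ∧ x ∉ SeqPrev X i ∧ ∀ u ∈ S, u ∉ SeqPrev X i → ¬ E u x := by
  rw [h.1 i hi hil]
  rfl

theorem mem_carrier (h : IsCanonicalSeq E S l X) {i : ℕ} {x : V} (hx : x ∈ X i) : x ∈ S :=
  ((h.mem_iff (h.index_bounds hx).1 (h.index_bounds hx).2).1 hx).1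

theorem notMem_seqPrev (h : IsCanonicalSeq E S l X) {i : ℕ} {x : V} (hx : x ∈ X i) :
    x ∉ SeqPrev X i :=
  ((h.mem_iff (h.index_bounds hx).1 (h.index_bounds hx).2).1 hx).2.1

/-- No arc leads from a level to the same or an earlier level. -/
theorem not_arc_of_le (h : IsCanonicalSeq E S l X) {p q : ℕ} (hpq : p ≤ q) {x y : V}
    (hx : x ∈ X p) (hy : y ∈ X q) : ¬ E y x := by
  refine ((h.mem_iff (h.index_bounds hx).1 (h.index_bounds hx).2).1 hx).2.2 y
    (h.mem_carrier hy) ?_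
  rintro ⟨j, hj, hjp, hyj⟩
  exact h.notMem_seqPrev hy ⟨j, hj, hjp.trans_le hpq, hyj⟩

theorem exists_arc_from_pred (h : IsCanonicalSeq E S l X) {i : ℕ} (hi : 1 ≤ i) {x : V}
    (hx : x ∈ X (i + 1)) : ∃ y ∈ X i, E y x := by
  have hil := (h.index_bounds hx).2
  have hxi := (h.mem_iff (by omega) hil).1 hx
  have hnot : x ∉ X i := fun hxi' => hxi.2.1 ⟨i, hi, by omega, hxi'⟩
  have hprev : x ∉ SeqPrev X i := fun ⟨j, hj, hji, hxj⟩ => hxi.2.1 ⟨j, hj, by omega, hxj⟩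
  rw [h.mem_iff hi (by omega)] at hnot
  push Not at hnot
  obtain ⟨y, hyS, hy, hyx⟩ := hnot hxi.1 hprev
  have hy' : y ∈ SeqPrev X (i + 1) := by
    by_contra hy'
    exact hxi.2.2 y hyS hy' hyx
  obtain ⟨j, hj, hji, hyj⟩ := hy'
  obtain rfl : j = i := by
    by_contra hne
    exact hy ⟨j, hj, by omega, hyj⟩
  exact ⟨y, hyj, hyx⟩

theorem nonempty (h : IsCanonicalSeq E S l X) {i : ℕ} (hi : 1 ≤ i) (hil : i ≤ l) :
    (X i).Nonempty := by
  induction hil using Nat.decreasingInduction with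
  | self =>
    by_contra hne
    rw [Set.not_nonempty_iff_eq_empty] at hne
    refine h.2.2.1 (l - 1) (by omega) ?_
    rw [← h.2.1, Nat.sub_add_cancel hi]
    ext x
    constructor
    · rintro ⟨j, hj, hjl, hx⟩
      exact ⟨j, hj, by omega, hx⟩
    · rintro ⟨j, hj, hjl, hx⟩
      refine ⟨j, hj, ?_, hx⟩
      rcases Nat.lt_succ_iff_lt_or_eq.1 hjl with hlt | rfl
      · exact hlt
      · simp [hne] at hx
  | of_succ k hk ih =>
    obtain ⟨x, hx⟩ := ih (by omega)
    obtain ⟨y, hy, -⟩ := h.exists_arc_from_pred hi hx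
    exact ⟨y, hy⟩

theorem exists_consecutive_arc (h : IsCanonicalSeq E S l X) {i : ℕ} (hi : 1 ≤ i)
    (hil : i + 1 ≤ l) : ∃ x ∈ X i, ∃ y ∈ X (i + 1), E x y := by
  obtain ⟨y, hy⟩ := h.nonempty (by omega) hil
  obtain ⟨x, hx, hxy⟩ := h.exists_arc_from_pred hi hy
  exact ⟨x, hx, y, hy, hxy⟩

theorem exists_arc_to_succ {A B : Set V} (h : IsCanonicalSeq E S l X)
    (hT : IsBipartiteTournament E A B) {i : ℕ} (hil : i + 1 ≤ l) {v : V} (hv : v ∈ X i) :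
    ∃ y ∈ X (i + 1), E v y := by
  obtain ⟨x, hx, y, hy, hxy⟩ := h.exists_consecutive_arc (h.index_bounds hv).1 hil
  refine ⟨y, hy, ?_⟩
  rcases hT.adj_left_or_adj_right hxy v with (hvx | hxv) | (hvy | hyv)
  · exact absurd hvx (h.not_arc_of_le le_rfl hx hv)
  · exact absurd hxv (h.not_arc_of_le le_rfl hv hx)
  · exact hvy
  · exact absurd hyv (h.not_arc_of_le (Nat.le_succ i) hv hy)

end IsCanonicalSeq

section MSequence

variable {E : V → V → Prop} {A B M : Set V} {l : ℕ} {X X' Y : ℕ → Set V}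

theorem MEquiv.arc_to_iff {u v m : V} (h : MEquiv E M u v) (hm : m ∈ M) : E u m ↔ E v m := by
  simpa [OutN, hm] using Set.ext_iff.1 h.1 m

theorem MEquiv.arc_from_iff {u v m : V} (h : MEquiv E M u v) (hm : m ∈ M) :
    E m u ↔ E m v := by
  simpa [InN, hm] using Set.ext_iff.1 h.2 m

theorem MUnivMinus.arc_to_of_adj {v m : V} (hT : IsBipartiteTournament E A B)
    (hv : MUnivMinus E M X v) (hm : m ∈ M) (hadj : E v m ∨ E m v) : E v m := by
  refine hadj.resolve_right fun hmv => ?_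
  obtain ⟨-, -, π, hπ, hlt⟩ := hv
  have hne : m ≠ v := fun hmv' => hT.irrefl v (hmv' ▸ hmv)
  exact lt_asymm (hlt m (.inl hm) hne) (hπ.2 m (.inl hm) v (.inr rfl) hmv)

theorem MUnivPlus.arc_from_of_adj {v m : V} (hT : IsBipartiteTournament E A B)
    (hv : MUnivPlus E M X v) (hm : m ∈ M) (hadj : E v m ∨ E m v) : E m v := by
  refine hadj.resolve_left fun hvm => ?_
  obtain ⟨-, -, π, hπ, hlt⟩ := hv
  have hne : m ≠ v := fun hmv' => hT.irrefl v (hmv' ▸ hvm)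
  exact lt_asymm (hlt m (.inl hm) hne) (hπ.2 v (.inr rfl) m (.inl hm) hvm)

theorem IsMSeqOn.mem_Y {U : Set V} (h : IsMSeqOn E U M l X' X Y) {i : ℕ} (hi : 1 ≤ i)
    (hil : i ≤ l) {w : V} (hw : w ∈ Y i) :
    MXConflict E X' i w ∨ (i = 1 ∧ MUnivMinus E M X' w) ∨ (i = l ∧ MUnivPlus E M X' w) := by
  rw [h.2.2.1 i hi hil] at hw
  split_ifs at hw <;> simp at hw <;> tauto

/-- A vertex of a block other than the last has an out-neighbor no later than the next level. -/
theorem IsMSeqOn.exists_arc_to (hT : IsBipartiteTournament E A B) {U : Set V}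
    (h : IsMSeqOn E U M l X' X Y) {j : ℕ} (hj : 1 ≤ j) (hjl : j + 1 ≤ l) {v : V}
    (hv : v ∈ X j ∪ Y j) : ∃ p ≤ j + 1, ∃ m ∈ X' p, E v m := by
  rcases hv with hv | hv
  · rw [h.2.1 j hj (by omega)] at hv
    obtain ⟨-, w, hw, hvw⟩ := hv
    obtain ⟨m, hm, hwm⟩ := h.1.exists_arc_to_succ hT hjl hw
    exact ⟨j + 1, le_rfl, m, hm, (hvw.arc_to_iff (h.1.mem_carrier hm)).2 hwm⟩
  · rcases h.mem_Y hj (by omega) hv with hc | ⟨-, hu⟩ | ⟨rfl, -⟩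
    · obtain ⟨m, hvm, hm⟩ := hc.1
      exact ⟨j, by omega, m, hm, hvm⟩
    · obtain ⟨x, hx, y, hy, hxy⟩ := h.1.exists_consecutive_arc hj hjl
      rcases hT.adj_left_or_adj_right hxy v with hadj | hadj
      · exact ⟨j, by omega, x, hx, hu.arc_to_of_adj hT (h.1.mem_carrier hx) hadj⟩
      · exact ⟨j + 1, le_rfl, y, hy, hu.arc_to_of_adj hT (h.1.mem_carrier hy) hadj⟩
    · omega

/-- A vertex of a block other than the first has an in-neighbor no earlier than the previous
level. -/
theorem IsMSeqOn.exists_arc_from (hT : IsBipartiteTournament E A B) {U : Set V}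
    (h : IsMSeqOn E U M l X' X Y) {i : ℕ} (hi : 1 ≤ i) (hil : i + 1 ≤ l) {u : V}
    (hu : u ∈ X (i + 1) ∪ Y (i + 1)) : ∃ q ≥ i, ∃ m ∈ X' q, E m u := by
  rcases hu with hu | hu
  · rw [h.2.1 (i + 1) (by omega) hil] at hu
    obtain ⟨-, w, hw, huw⟩ := hu
    obtain ⟨m, hm, hmw⟩ := h.1.exists_arc_from_pred hi hw
    exact ⟨i, le_rfl, m, hm, (huw.arc_from_iff (h.1.mem_carrier hm)).2 hmw⟩
  · rcases h.mem_Y (by omega) hil hu with hc | ⟨hi', -⟩ | ⟨-, hp⟩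
    · obtain ⟨m, hmu, hm⟩ := hc.2.1
      exact ⟨i + 1, by omega, m, hm, hmu⟩
    · omega
    · obtain ⟨x, hx, y, hy, hxy⟩ := h.1.exists_consecutive_arc hi hil
      rcases hT.adj_left_or_adj_right hxy u with hadj | hadj
      · exact ⟨i, le_rfl, x, hx, hp.arc_from_of_adj hT (h.1.mem_carrier hx) hadj⟩
      · exact ⟨i + 1, by omega, y, hy, hp.arc_from_of_adj hT (h.1.mem_carrier hy) hadj⟩

end MSequence

theorem stmt_13 [Fintype V] (E : V → V → Prop) (A B : Set V)
    (hT : IsBipartiteTournament E A B) (M : Set V)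
    (hcons : MConsistentOn E Set.univ M)
    (l : ℕ) (X' X Y : ℕ → Set V) (hseq : IsMSeqOn E Set.univ M l X' X Y)
    (S : Set V) (hS : IsFVS E S) (hSM : S ∩ M = ∅) :
    ∀ u v : V, ∀ i j, 1 ≤ j → j + 2 ≤ i → i ≤ l →
      u ∈ X i ∪ Y i → v ∈ X j ∪ Y j → E u v → u ∈ S ∨ v ∈ S := by
  intro u v i j hj hji hil hu hv huv
  obtain ⟨i, rfl⟩ : ∃ k, i = k + 1 := ⟨i - 1, by omega⟩
  obtain ⟨p, hp, m, hm, hvm⟩ := hseq.exists_arc_to hT hj (by omega) hv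
  obtain ⟨q, hq, m', hm', hmu⟩ := hseq.exists_arc_from hT (by omega) hil hu
  have hmm : E m m' := (hT.adj_of_walk_three hmu huv hvm).resolve_right
    (hseq.1.not_arc_of_le (by omega) hm hm')
  have hM : ∀ x ∈ M, x ∈ Sᶜ := fun x hx hxS =>
    Set.notMem_empty x (hSM ▸ Set.mem_inter hxS hx)
  have hmS := hM m (hseq.1.mem_carrier hm)
  have hmS' := hM m' (hseq.1.mem_carrier hm')
  by_contra! hS'
  exact hS u ((((Relation.TransGen.single ⟨hS'.1, hS'.2, huv⟩).tail ⟨hS'.2, hmS, hvm⟩).tail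
    ⟨hmS, hmS', hmm⟩).tail ⟨hmS', hS'.1, hmu⟩)
end

section
/- Let T be an acyclic bipartite tournament and let π and π' be two topological sorts of T. If u ≠ v are vertices with π(u) < π(v) but π'(v) < π'(u), then u and v are false twins; in other words, the topological sort of an acyclic bipartite tournament is unique up to permutations of false twins. -/
open Set

variable {V : Type*}

namespace IsBipartiteTournament

variable {E : V → V → Prop} {A B : Set V}

theorem swap (hT : IsBipartiteTournament E A B) : IsBipartiteTournament E B A := by
  obtain ⟨hU, hI, hX, hA, hB⟩ := hT
  exact ⟨Set.union_comm A B ▸ hU, Set.inter_comm A B ▸ hI,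
    fun b hb a ha => (hX a ha b hb).symm, hB, hA⟩

theorem mem_or_mem (hT : IsBipartiteTournament E A B) (w : V) : w ∈ A ∨ w ∈ B :=
  (Set.mem_union w A B).mp (hT.1 ▸ Set.mem_univ w)

/-- Two vertices of the same partite set with no directed path of length two between them
are false twins. -/
theorem falseTwins_of_mem_left (hT : IsBipartiteTournament E A B) {u v : V} (hu : u ∈ A)
    (hv : v ∈ A) (huv : ∀ w, ¬ (E u w ∧ E w v)) (hvu : ∀ w, ¬ (E v w ∧ E w u)) :
    FalseTwins E u v := by
  have key : ∀ w, (E u w ↔ E v w) ∧ (E w u ↔ E w v) := by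
    intro w
    have h₁ := huv w
    have h₂ := hvu w
    obtain ⟨-, -, hX, hA, -⟩ := id hT
    rcases hT.mem_or_mem w with hw | hw
    · simp [hA _ hu _ hw, hA _ hv _ hw, hA _ hw _ hu, hA _ hw _ hv]
    · have h₃ := xor_iff_iff_not.mp (hX u hu w hw)
      have h₄ := xor_iff_iff_not.mp (hX v hv w hw)
      tauto
  exact ⟨hT.2.2.2.1 u hu v hv, hT.2.2.2.1 v hv u hu, Set.ext fun w => (key w).1,
    Set.ext fun w => (key w).2⟩

/-- Two nonadjacent vertices with no directed path of length two between them are false twins. -/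
theorem falseTwins_of_not_adj (hT : IsBipartiteTournament E A B) {u v : V} (h : ¬ E u v)
    (h' : ¬ E v u) (huv : ∀ w, ¬ (E u w ∧ E w v)) (hvu : ∀ w, ¬ (E v w ∧ E w u)) :
    FalseTwins E u v := by
  rcases hT.mem_or_mem u with hu | hu <;> rcases hT.mem_or_mem v with hv | hv
  · exact hT.falseTwins_of_mem_left hu hv huv hvu
  · exact ((Xor.or (hT.2.2.1 u hu v hv)).elim h h').elim
  · exact ((Xor.or (hT.2.2.1 v hv u hu)).elim h' h).elim
  · exact hT.swap.falseTwins_of_mem_left hu hv huv hvu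

end IsBipartiteTournament

theorem stmt_16 [Fintype V] (E : V → V → Prop) (A B : Set V)
    (hT : IsBipartiteTournament E A B) (hac : AcyclicOn E Set.univ)
    (π π' : V ≃ Fin (Fintype.card V))
    (hπ : ∀ u v : V, E u v → π u < π v) (hπ' : ∀ u v : V, E u v → π' u < π' v)
    (u v : V) (huv : u ≠ v) (h1 : π u < π v) (h2 : π' v < π' u) :
    FalseTwins E u v := by
  refine hT.falseTwins_of_not_adj (fun h => (hπ' u v h).asymm h2) (fun h => (hπ v u h).asymm h1)
    (fun w h => ?_) (fun w h => ?_)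
  · exact ((hπ' u w h.1).trans (hπ' w v h.2)).asymm h2
  · exact ((hπ v w h.1).trans (hπ w u h.2)).asymm h1
end

section
/- Let T be an M-consistent bipartite tournament for some M ⊆ V(T) with canonical sequence (X_1, X_2, …) of T[M], and let v ∈ V(T) be a vertex that is neither (M,X_i)-equivalent for any i nor M-universal. Then v is (M,X_i)-conflicting, where X_i is the first set of the canonical sequence of T[M] that contains an out-neighbor of v; in particular, X_i contains both an in-neighbor and an out-neighbor of v, and no set X_j with j > i contains an in-neighbor of v. -/
open Set

variable {V : Type*}

/-- In a bipartite tournament two vertices are joined by an arc, in exactly one direction, if and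
only if they lie in different partite sets. -/
theorem IsBipartiteTournament.arc_iff {E : V → V → Prop} {A B : Set V}
    (hT : IsBipartiteTournament E A B) (x y : V) :
    E x y ↔ ¬(x ∈ A ↔ y ∈ A) ∧ ¬ E y x := by
  obtain ⟨hU, hI, hAB, hA, hB⟩ := hT
  have hmem : ∀ z, z ∈ B ↔ z ∉ A := fun z => by
    have h1 : z ∈ A ∪ B := hU ▸ mem_univ z
    have h2 : z ∉ A ∩ B := hI ▸ notMem_empty z
    simp only [mem_union, mem_inter_iff] at h1 h2
    tauto
  have h1 := hAB x
  have h2 := hAB y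
  have h3 := hA x
  have h4 := hB x
  simp only [hmem, Xor'] at h1 h2 h3 h4
  by_cases hx : x ∈ A <;> by_cases hy : y ∈ A <;> grind

/-- Every vertex has a unique level in a canonical sequence. The level increases along arcs, and
each vertex of level at least two has an in-neighbor on the preceding level. -/
theorem IsCanonicalSeq.exists_level {E : V → V → Prop} {S : Set V} {l : ℕ} {X : ℕ → Set V}
    (hX : IsCanonicalSeq E S l X) :
    ∃ r : V → ℕ, (∀ x i, x ∈ X i ↔ x ∈ S ∧ r x = i) ∧
      (∀ x ∈ S, 1 ≤ r x ∧ r x ≤ l) ∧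
      (∀ x ∈ S, ∀ y ∈ S, E x y → r x < r y) ∧
      (∀ y ∈ S, 2 ≤ r y → ∃ x ∈ S, E x y ∧ r x + 1 = r y) := by
  obtain ⟨hdef, hcov, -, hempty⟩ := hX
  have hrange : ∀ x i, x ∈ X i → 1 ≤ i ∧ i ≤ l := fun x i hx => by
    by_contra h
    rw [hempty i (by omega)] at hx
    exact hx
  have hXi : ∀ x i, x ∈ X i →
      x ∈ S ∧ x ∉ SeqPrev X i ∧ ∀ u ∈ S, u ∉ SeqPrev X i → ¬ E u x := fun x i hx => by
    have hi := hrange x i hx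
    rw [hdef i hi.1 hi.2] at hx
    exact hx
  have huniq : ∀ x i j, x ∈ X i → x ∈ X j → ¬ i < j := fun x i j hi hj hij =>
    (hXi x j hj).2.1 ⟨i, (hrange x i hi).1, hij, hi⟩
  have hex : ∀ x ∈ S, ∃ i, x ∈ X i := fun x hx => by
    rw [← hcov] at hx
    obtain ⟨i, -, -, hi⟩ := hx
    exact ⟨i, hi⟩
  choose! r hr using hex
  have hmem : ∀ x i, x ∈ X i ↔ x ∈ S ∧ r x = i := fun x i => by
    constructor
    · intro hx
      have hS := (hXi x i hx).1
      have h1 := huniq x _ _ hx (hr x hS)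
      have h2 := huniq x _ _ (hr x hS) hx
      exact ⟨hS, by omega⟩
    · rintro ⟨hS, rfl⟩
      exact hr x hS
  have hprev : ∀ x ∈ S, ∀ i, x ∈ SeqPrev X i ↔ r x < i := fun x hx i => by
    constructor
    · rintro ⟨j, -, hj, hxj⟩
      have := ((hmem x j).1 hxj).2
      omega
    · intro h
      exact ⟨r x, (hrange x _ (hr x hx)).1, h, hr x hx⟩
  have hlt : ∀ x ∈ S, ∀ y ∈ S, E x y → r x < r y := fun x hx y hy hxy => by
    by_contra h
    exact (hXi y _ (hr y hy)).2.2 x hx (fun h' => h ((hprev x hx _).1 h')) hxy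
  refine ⟨r, hmem, fun x hx => hrange x _ (hr x hx), hlt, fun y hy hy2 => ?_⟩
  by_contra! hno
  have hl := hrange y _ (hr y hy)
  have hy' : y ∈ X (r y - 1) := by
    rw [hdef _ (by omega) (by omega)]
    refine ⟨hy, fun h => ?_, fun u hu hup huy => ?_⟩
    · have := (hprev y hy _).1 h
      omega
    · rw [hprev u hu] at hup
      have h1 := hlt u hu y hy huy
      exact hno u hu huy (by omega)
  have := ((hmem y _).1 hy').2
  omega

/-- A rank function increasing along arcs can be refined to a topological sort. -/
theorem exists_isTopSortOn_of_rank [Finite V] {E : V → V → Prop} {S : Set V} (r : V → ℕ)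
    (hr : ∀ x ∈ S, ∀ y ∈ S, E x y → r x < r y) :
    ∃ π : V → ℕ, IsTopSortOn E S π ∧ ∀ x y, r x < r y → π x < π y := by
  obtain ⟨n, ⟨e⟩⟩ := Finite.exists_equiv_fin V
  have hmono : ∀ x y, r x < r y → r x * n + e x < r y * n + e y := fun x y h => by
    have h1 := (e x).isLt
    have h2 : (r x + 1) * n ≤ r y * n := Nat.mul_le_mul_right n h
    rw [add_mul] at h2
    omega
  refine ⟨fun x => r x * n + e x, ⟨fun x _ y _ hxy => ?_, fun x hx y hy h =>
    hmono x y (hr x hx y hy h)⟩, hmono⟩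
  have hxy' : r x * n + e x = r y * n + e y := hxy
  have h1 : r x = r y := by
    have h2 := hmono x y
    have h3 := hmono y x
    omega
  rw [h1] at hxy'
  exact e.injective (Fin.ext (by omega))

theorem stmt_17 [Fintype V] (E : V → V → Prop) (A B : Set V)
    (hT : IsBipartiteTournament E A B) (M : Set V)
    (hcons : MConsistentOn E Set.univ M)
    (l : ℕ) (X' : ℕ → Set V) (hX : IsCanonicalSeq E M l X') (v : V)
    (hne : ∀ i, ¬ MXEquiv E M X' i v) (hnu : ¬ MUniversal E M X' v) :
    ∃ i, 1 ≤ i ∧ i ≤ l ∧ (OutN E v ∩ X' i).Nonempty ∧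
      (∀ j, j < i → OutN E v ∩ X' j = ∅) ∧ MXConflict E X' i v := by
  classical
  obtain ⟨r, hmem, hrange, hlt, hpred⟩ := hX.exists_level
  have harc := hT.arc_iff
  have hacyc : AcyclicOn E (M ∪ {v}) := hcons v (mem_univ v)
  have hvM : v ∉ M := fun hv => hne (r v) ⟨v, (hmem v _).2 ⟨hv, rfl⟩, rfl, rfl⟩
  have hsort : ∀ c : ℕ, (∀ x ∈ M, E x v → r x < c) → (∀ x ∈ M, E v x → c < r x) →
      ∃ π : V → ℕ, IsTopSortOn E (M ∪ {v}) π ∧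
        ∀ x ∈ M, (r x < c → π x < π v) ∧ (c < r x → π v < π x) := by
    intro c hin hout
    have hupd : ∀ x ∈ M, Function.update r v c x = r x := fun x hx =>
      Function.update_of_ne (ne_of_mem_of_not_mem hx hvM) _ _
    have hvv : ¬ E v v := fun h => ((harc v v).1 h).1 Iff.rfl
    obtain ⟨π, hπ, hmono⟩ := exists_isTopSortOn_of_rank (E := E) (S := M ∪ {v})
      (Function.update r v c) (by
        rintro x (hx | rfl) y (hy | rfl) hxy
        · rw [hupd x hx, hupd y hy]
          exact hlt x hx y hy hxy
        · rw [hupd x hx, Function.update_self]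
          exact hin x hx hxy
        · rw [hupd y hy, Function.update_self]
          exact hout y hy hxy
        · exact absurd hxy hvv)
    refine ⟨π, hπ, fun x hx => ⟨fun h => hmono _ _ ?_, fun h => hmono _ _ ?_⟩⟩ <;>
      rwa [hupd x hx, Function.update_self]
  have hout : ∃ w ∈ M, E v w := by
    by_contra! hno
    obtain ⟨π, hπ, hlast⟩ := hsort (l + 1)
      (fun x hx _ => Nat.lt_succ_of_le (hrange x hx).2) (fun x hx h => absurd h (hno x hx))
    exact hnu (Or.inr ⟨hne, hacyc, π, hπ, fun u hu huv =>
      (hlast u (hu.resolve_right huv)).1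
        (Nat.lt_succ_of_le (hrange u (hu.resolve_right huv)).2)⟩)
  have hin : ∃ u ∈ M, E u v := by
    by_contra! hno
    obtain ⟨π, hπ, hfirst⟩ := hsort 0
      (fun x hx h => absurd h (hno x hx)) (fun x hx _ => (hrange x hx).1)
    exact hnu (Or.inl ⟨hne, hacyc, π, hπ, fun u hu huv =>
      (hfirst u (hu.resolve_right huv)).2 (hrange u (hu.resolve_right huv)).1⟩)
  have hexi : ∃ i, ∃ w ∈ M, E v w ∧ r w = i := by
    obtain ⟨w, hw, hvw⟩ := hout
    exact ⟨r w, w, hw, hvw, rfl⟩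
  obtain ⟨w, hw, hvw, hwi⟩ := Nat.find_spec hexi
  have hmin : ∀ x ∈ M, E v x → r w ≤ r x := fun x hx hvx =>
    hwi ▸ Nat.find_min' hexi ⟨x, hx, hvx, rfl⟩
  have hmax : ∀ u ∈ M, E u v → r u ≤ r w := by
    intro u hu huv
    by_contra! hlt'
    have h1 := hrange w hw
    obtain ⟨p, hp, hpu, hpr⟩ := hpred u hu (by omega)
    have hwp : E w p := by
      have h2 := hlt p hp w hw
      have h3 := harc w p
      have h4 := harc p u
      have h5 := harc v w
      have h6 := harc u v
      by_cases hpw : E p w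
      · have := h2 hpw
        omega
      · tauto
    have hM : ∀ x ∈ M, x ∈ M ∪ {v} := fun x hx => Or.inl hx
    have hv : v ∈ M ∪ {v} := Or.inr rfl
    exact hacyc v (((Relation.TransGen.single ⟨hv, hM w hw, hvw⟩).tail
      ⟨hM w hw, hM p hp, hwp⟩).tail ⟨hM p hp, hM u hu, hpu⟩ |>.tail ⟨hM u hu, hv, huv⟩)
  have hinw : ∃ u ∈ M, E u v ∧ r u = r w := by
    by_contra! hno
    have hless : ∀ u ∈ M, E u v → r u < r w := fun u hu huv =>
      lt_of_le_of_ne (hmax u hu huv) (hno u hu huv)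
    obtain ⟨u, hu, huv⟩ := hin
    have h1 := hrange u hu
    have h2 := hless u hu huv
    obtain ⟨p, hp, hpw, hpr⟩ := hpred w hw (by omega)
    have hside : p ∈ A ↔ v ∈ A := by
      have h3 := harc p w
      have h4 := harc v w
      tauto
    have key : ∀ x ∈ M, (E v x ↔ E p x) ∧ (E x v ↔ E x p) := by
      intro x hx
      have h3 := hmin x hx
      have h4 := hless x hx
      have h5 := hlt p hp x hx
      have h6 := hlt x hx p hp
      have h7 := harc v x
      have h8 := harc x v
      have h9 := harc p x
      have h10 := harc x p
      grind
    refine hne (r p) ⟨p, (hmem p _).2 ⟨hp, rfl⟩, ?_, ?_⟩ <;> ext x <;>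
      simp only [OutN, InN, mem_inter_iff, mem_ofPred_eq] <;> have := key x <;> tauto
  have hfirst : ∀ j, j < r w → OutN E v ∩ X' j = ∅ := by
    intro j hj
    ext x
    simp only [OutN, mem_inter_iff, mem_ofPred_eq, hmem, mem_empty_iff_false, iff_false]
    rintro ⟨hvx, hx, rfl⟩
    exact absurd (hmin x hx hvx) (by omega)
  have hne_out : (OutN E v ∩ X' (r w)).Nonempty := ⟨w, hvw, (hmem w _).2 ⟨hw, rfl⟩⟩
  refine ⟨r w, (hrange w hw).1, (hrange w hw).2, hne_out, hfirst, hne_out, ?_, hfirst, ?_⟩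
  · obtain ⟨u, hu, huv, hur⟩ := hinw
    exact ⟨u, huv, (hmem u _).2 ⟨hu, hur⟩⟩
  · intro j hj
    ext x
    simp only [InN, mem_inter_iff, mem_ofPred_eq, hmem, mem_empty_iff_false, iff_false]
    rintro ⟨hxv, hx, rfl⟩
    exact absurd (hmax x hx hxv) (by omega)
end
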